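/- Let K be an (N+1)×(N+1) positive semidefinite complex matrix and w₁,…,w_{N+1} ∈ ℂ be such that the matrix [(1 − w_i w̄_j)K_{ij}]_{i,j=1}^{N+1} is positive semidefinite. Suppose γ ∈ ℂᴺ satisfies Σ_{i,j=1}^{N} (1 − w_i w̄_j)K_{ij} γ_j γ̄_i = 0. Then w_{N+1} · Σ_{j=1}^{N} w̄_j K_{N+1,j} γ_j = Σ_{j=1}^{N} K_{N+1,j} γ_j. In particular, if Σ_{j=1}^{N} w̄_j K_{N+1,j} γ_j ≠ 0, then w_{N+1} = (Σ_{j=1}^{N} K_{N+1,j} γ_j) / (Σ_{j=1}^{N} w̄_j K_{N+1,j} γ_j). -/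

import Mathlib

open Matrix Complex
open scoped ComplexOrder

/-- **The formula for the value at an extra node (equations (4.8)–(4.9) of Agler–McCarthy).**
Let `K` be an `(N+1)×(N+1)` positive semidefinite matrix and `w₁,…,w_{N+1}` scalars such that
`[(1 - w_i w̄_j) K_{ij}]` is positive semidefinite. If `γ ∈ ℂᴺ` satisfies
`Σ_{i,j≤N} (1 - w_i w̄_j) K_{ij} γ_j γ̄_i = 0`, then
`w_{N+1} Σ_{j≤N} w̄_j K_{N+1,j} γ_j = Σ_{j≤N} K_{N+1,j} γ_j`; in particular if the left sum's
coefficient is nonzero then `w_{N+1}` is determined as the quotient of the two sums. -/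
theorem extra_node_value_formula (N : ℕ)
    (K : Matrix (Fin (N + 1)) (Fin (N + 1)) ℂ) (hK : K.PosSemidef)
    (w : Fin (N + 1) → ℂ)
    (hW : (Matrix.of fun i j => (1 - w i * (starRingEnd ℂ) (w j)) * K i j).PosSemidef)
    (γ : Fin N → ℂ)
    (hγ : ∑ i : Fin N, ∑ j : Fin N,
        (1 - w i.castSucc * (starRingEnd ℂ) (w j.castSucc)) * K i.castSucc j.castSucc *
          γ j * (starRingEnd ℂ) (γ i) = 0) :
    w (Fin.last N) * ∑ j : Fin N, (starRingEnd ℂ) (w j.castSucc) * K (Fin.last N) j.castSucc * γ j =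
      ∑ j : Fin N, K (Fin.last N) j.castSucc * γ j ∧
    ((∑ j : Fin N, (starRingEnd ℂ) (w j.castSucc) * K (Fin.last N) j.castSucc * γ j) ≠ 0 →
      w (Fin.last N) =
        (∑ j : Fin N, K (Fin.last N) j.castSucc * γ j) /
          (∑ j : Fin N, (starRingEnd ℂ) (w j.castSucc) * K (Fin.last N) j.castSucc * γ j)) := by
  set v : Fin (N + 1) → ℂ := Fin.snoc γ 0 with hv
  have hker := (hW.dotProduct_mulVec_zero_iff v).1 (by
    rw [← hγ]
    simp only [dotProduct, mulVec, Fin.sum_univ_castSucc, hv, Pi.star_apply, Fin.snoc_castSucc,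
      Fin.snoc_last, star_zero, zero_mul, mul_zero, add_zero, Matrix.of_apply]
    refine Finset.sum_congr rfl fun i _ => ?_
    rw [Finset.mul_sum]
    exact Finset.sum_congr rfl fun j _ => mul_comm _ _)
  have hlast := congrFun hker (Fin.last N)
  simp only [dotProduct, mulVec, Fin.sum_univ_castSucc, hv, Fin.snoc_castSucc,
    Fin.snoc_last, mul_zero, add_zero, Matrix.of_apply, Pi.zero_apply] at hlast
  have hmul : w (Fin.last N) *
      ∑ j : Fin N, (starRingEnd ℂ) (w j.castSucc) * K (Fin.last N) j.castSucc * γ j =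
      ∑ j : Fin N, K (Fin.last N) j.castSucc * γ j := by
    rw [eq_comm, ← sub_eq_zero, ← hlast, Finset.mul_sum, ← Finset.sum_sub_distrib]
    exact Finset.sum_congr rfl fun j _ => by ring
  exact ⟨hmul, fun h => eq_div_of_mul_eq h hmul⟩
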